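/- arXiv:2511.15356 — 2 statements merged into one kernel-verified Lean document; each statement's English description precedes it below -/
import Mathlib

section
/- The one-dimensional Gaussian dissipation integral equals the Gaussian entropy integral: ∫_ℝ φ(u)² / (Φ(u)(1 − Φ(u))) du = ∫_ℝ h(Φ(u)) du, where φ = Φ' is the standard Gaussian density; equivalently, √2 ∫_ℝ φ(u)²/(Φ(u)(1−Φ(u))) du = C. -/
open MeasureTheory Real Filter Set

noncomputable section

/-- The binary entropy function `h(u) = -u log u - (1-u) log (1-u)`. -/
def binEnt (u : ℝ) : ℝ := -(u * Real.log u) - (1 - u) * Real.log (1 - u)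

/-- The standard Gaussian density `φ(u) = (2π)^{-1/2} e^{-u²/2}`. -/
def gaussPDF (u : ℝ) : ℝ := (Real.sqrt (2 * Real.pi))⁻¹ * Real.exp (-(u ^ 2) / 2)

/-- The standard Gaussian cumulative distribution function `Φ`, with `Φ' = φ`. -/
def gaussCDF (a : ℝ) : ℝ := ∫ t in Set.Iic a, gaussPDF t

/-- The universal boundary-layer constant `C = √2 ∫_ℝ h(Φ(u)) du`. -/
def univC : ℝ := Real.sqrt 2 * ∫ u : ℝ, binEnt (gaussCDF u)

lemma binEnt_eq_binEntropy (p : ℝ) : binEnt p = binEntropy p := by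
  simp only [binEnt, binEntropy, Real.log_inv]
  ring

lemma gaussPDF_eq_gaussianPDFReal : gaussPDF = ProbabilityTheory.gaussianPDFReal 0 1 := by
  ext u
  simp [gaussPDF, ProbabilityTheory.gaussianPDFReal]

lemma integrable_gaussPDF : Integrable gaussPDF := by
  rw [gaussPDF_eq_gaussianPDFReal]
  exact ProbabilityTheory.integrable_gaussianPDFReal 0 1

lemma integral_gaussPDF : ∫ u, gaussPDF u = 1 := by
  rw [gaussPDF_eq_gaussianPDFReal]
  exact ProbabilityTheory.integral_gaussianPDFReal_eq_one 0 one_ne_zero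

lemma gaussPDF_pos (u : ℝ) : 0 < gaussPDF u := by
  unfold gaussPDF
  positivity

lemma gaussPDF_neg (u : ℝ) : gaussPDF (-u) = gaussPDF u := by
  simp [gaussPDF]

lemma gaussPDF_abs (u : ℝ) : gaussPDF |u| = gaussPDF u := by
  simp [gaussPDF]

lemma continuous_gaussPDF : Continuous gaussPDF := by
  unfold gaussPDF
  fun_prop

lemma hasDerivAt_gaussPDF (u : ℝ) : HasDerivAt gaussPDF (-u * gaussPDF u) u := by
  have h : HasDerivAt (fun x : ℝ => -(x ^ 2) / 2) (-u) u :=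
    ((hasDerivAt_pow 2 u).neg.div_const 2).congr_deriv (by push_cast; ring)
  refine (h.exp.const_mul (Real.sqrt (2 * Real.pi))⁻¹).congr_deriv ?_
  unfold gaussPDF
  ring

lemma gaussPDF_le_exp_neg_sq_div_two (u : ℝ) : gaussPDF u ≤ Real.exp (-(u ^ 2) / 2) := by
  have h : (Real.sqrt (2 * Real.pi))⁻¹ ≤ 1 := by
    apply inv_le_one_of_one_le₀
    rw [Real.one_le_sqrt]
    linarith [Real.pi_gt_three]
  exact mul_le_of_le_one_left (Real.exp_nonneg _) h

lemma gaussPDF_le_exp (u : ℝ) : gaussPDF u ≤ Real.exp u := by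
  have h : (Real.sqrt (2 * Real.pi))⁻¹ ≤ Real.exp (-1 / 2) := by
    rw [neg_div, Real.exp_neg]
    apply inv_anti₀ (Real.exp_pos _)
    apply Real.le_sqrt_of_sq_le
    rw [← Real.exp_nat_mul]
    norm_num
    linarith [Real.pi_gt_three, Real.exp_one_lt_d9]
  calc gaussPDF u ≤ Real.exp (-1 / 2) * Real.exp (-(u ^ 2) / 2) :=
        mul_le_mul_of_nonneg_right h (Real.exp_nonneg _)
    _ = Real.exp (-1 / 2 + -(u ^ 2) / 2) := (Real.exp_add _ _).symm
    _ ≤ Real.exp u := Real.exp_le_exp.2 (by nlinarith [sq_nonneg (u + 1)])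

lemma gaussPDF_le_exp_neg_abs (u : ℝ) : gaussPDF u ≤ Real.exp (-|u|) := by
  rw [← gaussPDF_abs, ← gaussPDF_neg]
  exact gaussPDF_le_exp _

lemma gaussPDF_le_of_abs_le {u v : ℝ} (h : |u| ≤ |v|) : gaussPDF v ≤ gaussPDF u := by
  have := sq_le_sq.2 h
  unfold gaussPDF
  gcongr

lemma gaussPDF_abs_add_one (u : ℝ) :
    gaussPDF (|u| + 1) = gaussPDF u * Real.exp (-(|u| + 1 / 2)) := by
  unfold gaussPDF
  rw [mul_assoc, ← Real.exp_add]
  congr 2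
  nlinarith [sq_abs u]

lemma one_sub_gaussCDF (u : ℝ) : 1 - gaussCDF u = gaussCDF (-u) := by
  have h : ∫ x in Iic (-u), gaussPDF (-x) = ∫ x in Ioi u, gaussPDF x := by
    simp
  have h' := intervalIntegral.integral_Iic_add_Ioi (b := u) integrable_gaussPDF.integrableOn
    integrable_gaussPDF.integrableOn
  simp only [gaussPDF_neg] at h
  rw [integral_gaussPDF] at h'
  simp only [gaussCDF]
  linarith

lemma gaussPDF_abs_add_one_le_gaussCDF (u : ℝ) : gaussPDF (|u| + 1) ≤ gaussCDF u := by
  have hsub : ∫ t in Icc (u - 1) u, gaussPDF t ≤ gaussCDF u :=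
    setIntegral_mono_set integrable_gaussPDF.integrableOn
      (ae_of_all _ fun t => (gaussPDF_pos t).le) Icc_subset_Iic_self.eventuallyLE
  have hconst : ∫ _t in Icc (u - 1) u, gaussPDF (|u| + 1) ≤ ∫ t in Icc (u - 1) u, gaussPDF t := by
    refine setIntegral_mono_on (by simp) integrable_gaussPDF.integrableOn measurableSet_Icc ?_
    intro t ht
    apply gaussPDF_le_of_abs_le
    rw [abs_of_nonneg (by positivity : 0 ≤ |u| + 1), abs_le]
    constructor <;> linarith [ht.1, ht.2, le_abs_self u, neg_abs_le u]
  refine le_trans ?_ (hconst.trans hsub)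
  simp

lemma gaussCDF_pos (u : ℝ) : 0 < gaussCDF u :=
  (gaussPDF_pos _).trans_le (gaussPDF_abs_add_one_le_gaussCDF u)

lemma gaussCDF_lt_one (u : ℝ) : gaussCDF u < 1 := by
  linarith [one_sub_gaussCDF u, gaussCDF_pos (-u)]

lemma gaussCDF_le_exp (u : ℝ) : gaussCDF u ≤ Real.exp u := by
  rw [← integral_exp_Iic]
  exact setIntegral_mono integrable_gaussPDF.integrableOn (integrableOn_exp_Iic u) gaussPDF_le_exp

lemma hasDerivAt_gaussCDF (u : ℝ) : HasDerivAt gaussCDF (gaussPDF u) u := by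
  have h : gaussCDF = fun x => gaussCDF 0 + ∫ t in (0 : ℝ)..x, gaussPDF t := by
    ext x
    have := intervalIntegral.integral_Iic_sub_Iic (a := 0) (b := x)
      integrable_gaussPDF.integrableOn integrable_gaussPDF.integrableOn
    simp only [gaussCDF]
    linarith
  rw [h]
  exact (intervalIntegral.integral_hasDerivAt_right (continuous_gaussPDF.intervalIntegrable _ _)
    continuous_gaussPDF.stronglyMeasurable.stronglyMeasurableAtFilter
    continuous_gaussPDF.continuousAt).const_add _

lemma continuous_gaussCDF : Continuous gaussCDF :=
  continuous_iff_continuousAt.2 fun u => (hasDerivAt_gaussCDF u).continuousAt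

lemma negMulLog_le_two_mul_sqrt {p : ℝ} (hp : 0 < p) : -(p * Real.log p) ≤ 2 * √p := by
  have hs := Real.sqrt_pos.2 hp
  have hlog := Real.one_sub_inv_le_log_of_pos hs
  have hsq := Real.sq_sqrt hp.le
  rw [Real.log_sqrt hp.le] at hlog
  have hmul := mul_le_mul_of_nonneg_left hlog hp.le
  have hinv : p * (√p)⁻¹ = √p := by
    rw [← div_eq_mul_inv, Real.div_sqrt]
  nlinarith

lemma binEnt_le_three_mul_sqrt {p : ℝ} (hp : 0 < p) (hp1 : p < 1) : binEnt p ≤ 3 * √p := by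
  have h1 := negMulLog_le_two_mul_sqrt hp
  have hq : 0 < 1 - p := by linarith
  have h2 := mul_le_mul_of_nonneg_left (Real.one_sub_inv_le_log_of_pos hq) hq.le
  rw [mul_sub, mul_inv_cancel₀ hq.ne'] at h2
  have h3 : p ≤ √p := Real.le_sqrt_of_sq_le (by nlinarith)
  unfold binEnt
  linarith

lemma binEnt_gaussCDF_nonneg (u : ℝ) : 0 ≤ binEnt (gaussCDF u) := by
  rw [binEnt_eq_binEntropy]
  exact binEntropy_nonneg (gaussCDF_pos u).le (gaussCDF_lt_one u).le

lemma binEnt_gaussCDF_neg (u : ℝ) : binEnt (gaussCDF (-u)) = binEnt (gaussCDF u) := by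
  rw [← one_sub_gaussCDF, binEnt_eq_binEntropy, binEntropy_one_sub, binEnt_eq_binEntropy]

lemma binEnt_gaussCDF_le (u : ℝ) : binEnt (gaussCDF u) ≤ 3 * Real.exp (-(1 / 2) * |u|) := by
  have key (v : ℝ) : binEnt (gaussCDF v) ≤ 3 * Real.exp (v / 2) := by
    refine (binEnt_le_three_mul_sqrt (gaussCDF_pos v) (gaussCDF_lt_one v)).trans ?_
    rw [Real.exp_half]
    gcongr
    exact gaussCDF_le_exp v
  rcases abs_cases u with ⟨h, -⟩ | ⟨h, -⟩ <;> rw [h]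
  · rw [← binEnt_gaussCDF_neg]
    exact (key _).trans_eq (by ring_nf)
  · exact (key _).trans_eq (by ring_nf)

lemma integrable_exp_neg_mul_abs {c : ℝ} (hc : 0 < c) :
    Integrable fun u : ℝ => Real.exp (-c * |u|) := by
  rw [← integrableOn_univ, ← Iic_union_Ioi (a := (0 : ℝ))]
  refine IntegrableOn.union ?_ ?_
  · refine (integrableOn_exp_mul_Iic hc 0).congr_fun (fun x hx => ?_) measurableSet_Iic
    simp [abs_of_nonpos (mem_Iic.1 hx)]
  · refine (integrableOn_exp_mul_Ioi (neg_neg_of_pos hc) 0).congr_fun (fun x hx => ?_)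
      measurableSet_Ioi
    simp [abs_of_pos (mem_Ioi.1 hx)]

lemma integrable_binEnt_gaussCDF : Integrable fun u : ℝ => binEnt (gaussCDF u) := by
  refine ((integrable_exp_neg_mul_abs one_half_pos).const_mul 3).mono' ?_ (ae_of_all _ fun u => ?_)
  · simp only [binEnt_eq_binEntropy]
    exact (binEntropy_continuous.comp continuous_gaussCDF).aestronglyMeasurable
  · rw [Real.norm_of_nonneg (binEnt_gaussCDF_nonneg u)]
    exact binEnt_gaussCDF_le u

lemma gaussPDF_abs_add_one_div_two_le (u : ℝ) :
    gaussPDF (|u| + 1) / 2 ≤ gaussCDF u * (1 - gaussCDF u) := by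
  have h1 := gaussPDF_abs_add_one_le_gaussCDF u
  have h2 := gaussPDF_abs_add_one_le_gaussCDF (-u)
  rw [abs_neg, ← one_sub_gaussCDF] at h2
  have h3 := gaussPDF_pos (|u| + 1)
  rcases le_total (gaussCDF u) (1 / 2) with h | h <;> nlinarith

lemma gaussPDF_sq_div_le (u : ℝ) : gaussPDF u ^ 2 / (gaussCDF u * (1 - gaussCDF u)) ≤
    2 * Real.exp (5 / 2) * Real.exp (-1 * |u|) := by
  have h0 := gaussPDF_pos (|u| + 1)
  have hp := gaussPDF_pos u
  calc gaussPDF u ^ 2 / (gaussCDF u * (1 - gaussCDF u))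
      ≤ gaussPDF u ^ 2 / (gaussPDF (|u| + 1) / 2) := by
        gcongr
        exact gaussPDF_abs_add_one_div_two_le u
    _ = 2 * (gaussPDF u * Real.exp (|u| + 1 / 2)) := by
        rw [gaussPDF_abs_add_one, Real.exp_neg]
        field_simp
    _ ≤ 2 * (Real.exp (-(u ^ 2) / 2) * Real.exp (|u| + 1 / 2)) := by
        gcongr
        exact gaussPDF_le_exp_neg_sq_div_two u
    _ ≤ 2 * Real.exp (5 / 2) * Real.exp (-1 * |u|) := by
        rw [mul_assoc, ← Real.exp_add, ← Real.exp_add]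
        apply mul_le_mul_of_nonneg_left _ zero_le_two
        apply Real.exp_le_exp.2
        nlinarith [sq_nonneg (|u| - 2), sq_abs u]

lemma integrable_gaussPDF_sq_div :
    Integrable fun u : ℝ => gaussPDF u ^ 2 / (gaussCDF u * (1 - gaussCDF u)) := by
  refine ((integrable_exp_neg_mul_abs one_pos).const_mul (2 * Real.exp (5 / 2))).mono' ?_
    (ae_of_all _ fun u => ?_)
  · exact ((continuous_gaussPDF.pow 2).measurable.div (continuous_gaussCDF.mul
      (continuous_const.sub continuous_gaussCDF)).measurable).aestronglyMeasurable
  · have h1 := gaussCDF_pos u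
    have h2 := sub_pos.2 (gaussCDF_lt_one u)
    rw [Real.norm_of_nonneg (by positivity)]
    exact gaussPDF_sq_div_le u

/-- The difference of the two integrands is the derivative of this function, which vanishes at
infinity. -/
def entropyPrimitive (u : ℝ) : ℝ :=
  gaussPDF u * (Real.log (1 - gaussCDF u) - Real.log (gaussCDF u)) + u * binEnt (gaussCDF u)

lemma hasDerivAt_entropyPrimitive (u : ℝ) : HasDerivAt entropyPrimitive
    (binEnt (gaussCDF u) - gaussPDF u ^ 2 / (gaussCDF u * (1 - gaussCDF u))) u := by
  have h1 := (gaussCDF_pos u).ne'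
  have h2 := (sub_pos.2 (gaussCDF_lt_one u)).ne'
  have hΦ := hasDerivAt_gaussCDF u
  have hlog := ((hΦ.const_sub 1).log h2).sub (hΦ.log h1)
  have hent : HasDerivAt (fun x => binEnt (gaussCDF x))
      ((Real.log (1 - gaussCDF u) - Real.log (gaussCDF u)) * gaussPDF u) u := by
    simp only [binEnt_eq_binEntropy]
    exact (hasDerivAt_binEntropy h1 (gaussCDF_lt_one u).ne).comp u hΦ
  refine (((hasDerivAt_gaussPDF u).mul hlog).add ((hasDerivAt_id u).mul hent)).congr_deriv ?_
  simp only [id, Pi.sub_apply]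
  field_simp
  ring

lemma gaussPDF_mul_neg_log_gaussCDF_le (u : ℝ) : gaussPDF u * -Real.log (gaussCDF u) ≤
    (3 + |u|) * Real.exp (-(1 / 2) * |u|) := by
  have hp := gaussPDF_pos u
  have hlog := Real.log_le_log (gaussPDF_pos _) (gaussPDF_abs_add_one_le_gaussCDF u)
  rw [gaussPDF_abs_add_one, Real.log_mul hp.ne' (Real.exp_pos _).ne', Real.log_exp] at hlog
  have hsqrt : √(gaussPDF u) ≤ Real.exp (-(1 / 2) * |u|) := by
    rw [show -(1 / 2) * |u| = -|u| / 2 by ring, Real.exp_half]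
    exact Real.sqrt_le_sqrt (gaussPDF_le_exp_neg_abs u)
  have hle : gaussPDF u ≤ Real.exp (-(1 / 2) * |u|) := by
    refine (gaussPDF_le_exp_neg_abs u).trans (Real.exp_le_exp.2 ?_)
    linarith [abs_nonneg u]
  have h2 := negMulLog_le_two_mul_sqrt hp
  have h3 := mul_le_mul_of_nonneg_left hlog hp.le
  have h4 := mul_le_mul_of_nonneg_right hle (by positivity : 0 ≤ |u| + 1 / 2)
  nlinarith [Real.exp_pos (-(1 / 2) * |u|)]

lemma abs_entropyPrimitive_le (u : ℝ) :
    |entropyPrimitive u| ≤ (6 + 5 * |u|) * Real.exp (-(1 / 2) * |u|) := by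
  have h1 := gaussPDF_mul_neg_log_gaussCDF_le u
  have h2 := gaussPDF_mul_neg_log_gaussCDF_le (-u)
  rw [gaussPDF_neg, abs_neg, ← one_sub_gaussCDF] at h2
  have hp := (gaussPDF_pos u).le
  have l1 := mul_nonneg hp (neg_nonneg.2 (Real.log_nonpos (gaussCDF_pos u).le
    (gaussCDF_lt_one u).le))
  have l2 := mul_nonneg hp (neg_nonneg.2 (Real.log_nonpos (sub_pos.2 (gaussCDF_lt_one u)).le
    (by linarith [gaussCDF_pos u])))
  have h3 : |u * binEnt (gaussCDF u)| ≤ |u| * (3 * Real.exp (-(1 / 2) * |u|)) := by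
    rw [abs_mul, abs_of_nonneg (binEnt_gaussCDF_nonneg u)]
    gcongr
    exact binEnt_gaussCDF_le u
  refine (abs_add_le _ _).trans ?_
  have h4 : |gaussPDF u * (Real.log (1 - gaussCDF u) - Real.log (gaussCDF u))| ≤
      2 * ((3 + |u|) * Real.exp (-(1 / 2) * |u|)) := by
    rw [abs_le]
    constructor <;> nlinarith
  linarith

lemma tendsto_entropyPrimitive {l : Filter ℝ} (hl : Tendsto (fun u : ℝ => |u|) l atTop) :
    Tendsto entropyPrimitive l (nhds 0) := by
  have hx : Tendsto (fun x : ℝ => (6 + 5 * x) * Real.exp (-(1 / 2) * x)) atTop (nhds 0) := by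
    have h0 := (tendsto_pow_mul_exp_neg_atTop_nhds_zero 0).comp
      (tendsto_id.atTop_mul_const (one_half_pos (α := ℝ)))
    have h1 := (tendsto_pow_mul_exp_neg_atTop_nhds_zero 1).comp
      (tendsto_id.atTop_mul_const (one_half_pos (α := ℝ)))
    convert (h0.const_mul 6).add (h1.const_mul 10) using 1
    · ext x
      simp only [Function.comp, id, pow_zero, pow_one,
        show -(1 / 2) * x = -(x * (1 / 2)) by ring]
      ring
    · simp
  exact squeeze_zero_norm abs_entropyPrimitive_le (hx.comp hl)

/-- **The one-dimensional Gaussian dissipation integral equals the Gaussian entropy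
integral:**
`∫_ℝ φ(u)² / (Φ(u)(1 − Φ(u))) du = ∫_ℝ h(Φ(u)) du`,
where `φ = Φ'` is the standard Gaussian density; both integrals are finite (this is
part of the claim), and equivalently `√2 ∫_ℝ φ(u)²/(Φ(u)(1−Φ(u))) du = C`. -/
theorem gaussian_dissipation_eq_entropy_integral :
    Integrable (fun u : ℝ => gaussPDF u ^ 2 / (gaussCDF u * (1 - gaussCDF u))) ∧
    Integrable (fun u : ℝ => binEnt (gaussCDF u)) ∧
    (∫ u : ℝ, gaussPDF u ^ 2 / (gaussCDF u * (1 - gaussCDF u)))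
      = ∫ u : ℝ, binEnt (gaussCDF u) ∧
    Real.sqrt 2 * (∫ u : ℝ, gaussPDF u ^ 2 / (gaussCDF u * (1 - gaussCDF u)))
      = univC := by
  have hint := integral_of_hasDerivAt_of_tendsto hasDerivAt_entropyPrimitive
    (integrable_binEnt_gaussCDF.sub integrable_gaussPDF_sq_div)
    (tendsto_entropyPrimitive tendsto_abs_atBot_atTop)
    (tendsto_entropyPrimitive tendsto_abs_atTop_atTop)
  rw [integral_sub integrable_binEnt_gaussCDF integrable_gaussPDF_sq_div, sub_self] at hint
  have heq := (sub_eq_zero.1 hint).symm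
  exact ⟨integrable_gaussPDF_sq_div, integrable_binEnt_gaussCDF, heq, by rw [heq, univC]⟩

end
end

section
/- Euclidean L¹ heat-content law for finite-perimeter sets: let E ⊂ ℝⁿ be a set of finite perimeter and p_t = 1_E * G_t its Gaussian smoothing. Then as t ↓ 0, ‖p_t − 1_E‖_{L¹(ℝⁿ)} = (2/√π) √t · Per(E) + o(√t). -/
open MeasureTheory Real Filter Set Topology
open scoped RealInnerProductSpace

noncomputable section

/-- The Euclidean heat kernel `G_t(z) = (4πt)^{-n/2} e^{-|z|²/(4t)}` on `ℝⁿ`. -/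
def heatKer (n : ℕ) (t : ℝ) (z : EuclideanSpace ℝ (Fin n)) : ℝ :=
  (4 * Real.pi * t) ^ (-(n : ℝ) / 2) * Real.exp (-‖z‖ ^ 2 / (4 * t))

/-- The divergence of a vector field on `ℝⁿ`. -/
def divergence (n : ℕ) (X : EuclideanSpace ℝ (Fin n) → EuclideanSpace ℝ (Fin n))
    (x : EuclideanSpace ℝ (Fin n)) : ℝ :=
  ∑ i : Fin n, ⟪fderiv ℝ X x (EuclideanSpace.single i 1), EuclideanSpace.single i 1⟫

/-- The family of trial values defining the De Giorgi perimeter of `E ⊆ ℝⁿ`. -/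
def perimSet (n : ℕ) (E : Set (EuclideanSpace ℝ (Fin n))) : Set ℝ :=
  { r | ∃ X : EuclideanSpace ℝ (Fin n) → EuclideanSpace ℝ (Fin n),
      ContDiff ℝ 1 X ∧ HasCompactSupport X ∧ (∀ x, ‖X x‖ ≤ 1) ∧
      r = ∫ x in E, divergence n X x }

/-- The De Giorgi perimeter `Per(E) = |D 1_E|(ℝⁿ) = H^{n−1}(∂*E)`. -/
def perim (n : ℕ) (E : Set (EuclideanSpace ℝ (Fin n))) : ℝ := sSup (perimSet n E)

/-- `E ⊆ ℝⁿ` has finite perimeter. -/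
def HasFinitePerimeter (n : ℕ) (E : Set (EuclideanSpace ℝ (Fin n))) : Prop :=
  BddAbove (perimSet n E)

/-- The absolute first moment of the standard normal law. -/
lemma lintegral_enorm_gaussianReal :
    ∫⁻ x, ‖x‖ₑ ∂(ProbabilityTheory.gaussianReal 0 1) = ENNReal.ofReal √(2 / π) := by
  have hint : ∫ x : ℝ, |x| * ProbabilityTheory.gaussianPDFReal 0 1 x = √(2 / π) := by
    have h1 : ∀ x : ℝ, |x| * ProbabilityTheory.gaussianPDFReal 0 1 x
        = (fun y : ℝ => (√(2 * π))⁻¹ * (y * rexp (-(1 / 2) * y ^ 2))) |x| := by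
      intro x
      simp only [ProbabilityTheory.gaussianPDFReal, sq_abs, NNReal.coe_one, mul_one, sub_zero]
      rw [show -x ^ 2 / 2 = -(1 / 2) * x ^ 2 by ring]
      ring
    rw [integral_congr_ae (ae_of_all _ h1),
      integral_comp_abs (f := fun y => (√(2 * π))⁻¹ * (y * rexp (-(1 / 2) * y ^ 2))),
      integral_const_mul]
    have h2 : ∫ x in Ioi (0 : ℝ), x * rexp (-(1 / 2) * x ^ 2) = 1 := by
      have := integral_rpow_mul_exp_neg_mul_rpow (p := 2) (q := 1) (b := 1 / 2)
        (by norm_num) (by norm_num) (by norm_num)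
      norm_num at this ⊢
      exact this
    rw [h2, mul_one, Real.sqrt_mul (by norm_num), Real.sqrt_div (by norm_num)]
    have h3 : √2 * √2 = 2 := Real.mul_self_sqrt (by norm_num)
    field_simp
    linarith
  have hmem : Integrable (fun x : ℝ => x) (ProbabilityTheory.gaussianReal 0 1) :=
    (ProbabilityTheory.memLp_id_gaussianReal 1).integrable (by norm_num)
  have h := ofReal_integral_norm_eq_lintegral_enorm hmem
  rw [← h, ProbabilityTheory.integral_gaussianReal_eq_integral_smul (by norm_num)]
  congr 1
  rw [← hint]
  exact integral_congr_ae (ae_of_all _ fun x => by simp [mul_comm])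

/-- Under the standard Gaussian measure the functional `L` is a centered normal variable with
standard deviation `‖L‖`; this computes its absolute first moment. -/
lemma lintegral_enorm_dual_stdGaussian {F : Type*} [NormedAddCommGroup F] [InnerProductSpace ℝ F]
    [FiniteDimensional ℝ F] [MeasurableSpace F] [BorelSpace F] (L : F →L[ℝ] ℝ) :
    ∫⁻ k, ‖L k‖ₑ ∂(ProbabilityTheory.stdGaussian F) = ENNReal.ofReal √(2 / π) * ‖L‖ₑ := by
  have hmap : (ProbabilityTheory.stdGaussian F).map L
      = (ProbabilityTheory.gaussianReal 0 1).map (‖L‖ * ·) := by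
    rw [ProbabilityTheory.IsGaussian.map_eq_gaussianReal L,
      ProbabilityTheory.gaussianReal_map_const_mul,
      ProbabilityTheory.variance_dual_stdGaussian,
      ProbabilityTheory.integral_strongDual_stdGaussian]
    congr 1
    · simp
    · ext; simp
  calc ∫⁻ k, ‖L k‖ₑ ∂(ProbabilityTheory.stdGaussian F)
      = ∫⁻ x, ‖x‖ₑ ∂((ProbabilityTheory.stdGaussian F).map L) := by
        rw [lintegral_map (by fun_prop) (by fun_prop)]
    _ = ∫⁻ x, ‖L‖ₑ * ‖x‖ₑ ∂(ProbabilityTheory.gaussianReal 0 1) := by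
        rw [hmap, lintegral_map (by fun_prop) (by fun_prop)]
        simp_rw [enorm_mul, enorm_norm]
    _ = _ := by
        rw [lintegral_const_mul _ (by fun_prop), lintegral_enorm_gaussianReal, mul_comm]

section HeatKernel

variable {n : ℕ} {t : ℝ}

lemma continuous_heatKer : Continuous (heatKer n t) := by
  unfold heatKer
  fun_prop

lemma heatKer_nonneg (ht : 0 < t) (z : EuclideanSpace ℝ (Fin n)) : 0 ≤ heatKer n t z := by
  unfold heatKer
  positivity

lemma heatKer_neg (z : EuclideanSpace ℝ (Fin n)) : heatKer n t (-z) = heatKer n t z := by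
  simp [heatKer]

lemma integral_heatKer (ht : 0 < t) : ∫ z, heatKer n t z = 1 := by
  have h := GaussianFourier.integral_rexp_neg_mul_sq_norm (V := EuclideanSpace ℝ (Fin n))
    (b := (4 * t)⁻¹) (by positivity)
  simp only [heatKer]
  rw [integral_const_mul]
  have h1 : ∀ z : EuclideanSpace ℝ (Fin n), -‖z‖ ^ 2 / (4 * t) = -(4 * t)⁻¹ * ‖z‖ ^ 2 := by
    intro z; ring
  simp_rw [h1, h]
  rw [finrank_euclideanSpace_fin, show π / (4 * t)⁻¹ = 4 * π * t by field_simp,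
    ← Real.rpow_add (by positivity)]
  rw [show -(n : ℝ) / 2 + n / 2 = 0 by ring, Real.rpow_zero]

lemma integrable_heatKer (ht : 0 < t) : Integrable (heatKer n t) :=
  Integrable.of_integral_ne_zero (by rw [integral_heatKer ht]; norm_num)

/-- The heat kernel is the density of a dilated standard Gaussian measure. -/
lemma withDensity_heatKer (ht : 0 < t) :
    (volume : Measure (EuclideanSpace ℝ (Fin n))).withDensity
        (fun z => ENNReal.ofReal (heatKer n t z))
      = (ProbabilityTheory.stdGaussian (EuclideanSpace ℝ (Fin n))).map (√(2 * t) • ·) := by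
  have : IsFiniteMeasure ((volume : Measure (EuclideanSpace ℝ (Fin n))).withDensity
      (fun z => ENNReal.ofReal (heatKer n t z))) :=
    isFiniteMeasure_withDensity_ofReal (integrable_heatKer ht).2
  apply Measure.ext_of_charFun
  ext ξ
  rw [charFun_map_smul, ProbabilityTheory.charFun_stdGaussian, charFun_apply,
    integral_withDensity_eq_integral_toReal_smul continuous_heatKer.measurable.ennreal_ofReal
      (ae_of_all _ fun _ => ENNReal.ofReal_lt_top)]
  have h := GaussianFourier.integral_cexp_neg_mul_sq_norm_add (V := EuclideanSpace ℝ (Fin n))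
    (b := ((4 * t)⁻¹ : ℝ)) (by rw [Complex.ofReal_re]; positivity) Complex.I ξ
  have h1 : ∀ z : EuclideanSpace ℝ (Fin n),
      (ENNReal.ofReal (heatKer n t z)).toReal • Complex.exp (⟪z, ξ⟫ * Complex.I)
      = ((4 * π * t) ^ (-(n : ℝ) / 2) : ℝ) *
        Complex.exp (-((4 * t)⁻¹ : ℝ) * ‖z‖ ^ 2 + Complex.I * ⟪ξ, z⟫) := by
    intro z
    rw [ENNReal.toReal_ofReal (heatKer_nonneg ht z), heatKer, Complex.exp_add, Complex.real_smul,
      real_inner_comm]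
    push_cast
    rw [mul_assoc, mul_comm Complex.I]
    congr 4
    ring
  simp_rw [h1]
  rw [integral_const_mul, h, ← mul_assoc]
  have h2 : ((((4 * π * t) ^ (-(n : ℝ) / 2) : ℝ) : ℂ) * ((π : ℂ) / ((4 * t)⁻¹ : ℝ)) ^
      ((Module.finrank ℝ (EuclideanSpace ℝ (Fin n)) : ℂ) / 2)) = 1 := by
    rw [finrank_euclideanSpace_fin, ← Complex.ofReal_div,
      show π / (4 * t)⁻¹ = 4 * π * t by field_simp,
      show ((n : ℂ) / 2) = ((n / 2 : ℝ) : ℂ) by push_cast; rfl,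
      ← Complex.ofReal_cpow (by positivity), ← Complex.ofReal_mul,
      ← Real.rpow_add (by positivity), show -(n : ℝ) / 2 + n / 2 = 0 by ring, Real.rpow_zero,
      Complex.ofReal_one]
  rw [h2, one_mul, norm_smul, Complex.I_sq, Real.norm_of_nonneg (by positivity)]
  congr 1
  have h3 : ((√(2 * t) : ℝ) : ℂ) ^ 2 = 2 * t := by
    rw [← Complex.ofReal_pow, Real.sq_sqrt (by positivity)]; push_cast; rfl
  have h4 : (t : ℂ) ≠ 0 := by exact_mod_cast ht.ne'
  push_cast
  rw [mul_pow, h3]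
  field_simp

lemma lintegral_heatKer_mul (ht : 0 < t) {V : EuclideanSpace ℝ (Fin n) → ENNReal}
    (hV : Measurable V) :
    ∫⁻ h, ENNReal.ofReal (heatKer n t h) * V h
      = ∫⁻ k, V (√(2 * t) • k) ∂(ProbabilityTheory.stdGaussian (EuclideanSpace ℝ (Fin n))) := by
  rw [← lintegral_map hV (by fun_prop), ← withDensity_heatKer ht,
    lintegral_withDensity_eq_lintegral_mul _ continuous_heatKer.measurable.ennreal_ofReal hV]
  rfl

end HeatKernel

section DifferenceQuotients

open scoped Convolution

variable {F : Type*} [NormedAddCommGroup F] [InnerProductSpace ℝ F] [FiniteDimensional ℝ F]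
  [MeasurableSpace F] [BorelSpace F]

/-- The `L¹` norm of the increment `u (· + h) - u`. -/
def diffNorm (u : F → ℝ) (h : F) : ENNReal := ∫⁻ x, ‖u (x + h) - u x‖ₑ

lemma measurable_diffNorm {u : F → ℝ} (hu : Measurable u) : Measurable (diffNorm u) := by
  have : Measurable fun p : F × F => ‖u (p.2 + p.1) - u p.2‖ₑ := by fun_prop
  exact this.lintegral_prod_right'

lemma diffNorm_le_lintegral_fderiv {u : F → ℝ} (hu : ContDiff ℝ 1 u) (h : F) :
    diffNorm u h ≤ ∫⁻ x, ‖fderiv ℝ u x h‖ₑ := by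
  have hcont : Continuous fun p : F × ℝ => fderiv ℝ u (p.1 + p.2 • h) h :=
    ((hu.continuous_fderiv one_ne_zero).comp (by fun_prop)).clm_apply continuous_const
  have hpt : ∀ x, ‖u (x + h) - u x‖ₑ
      ≤ ∫⁻ s in Ioc (0 : ℝ) 1, ‖fderiv ℝ u (x + s • h) h‖ₑ := by
    intro x
    have hc : Continuous fun s : ℝ => fderiv ℝ u (x + s • h) h :=
      hcont.comp (by fun_prop : Continuous fun s : ℝ => (x, s))
    have hd : ∀ s ∈ uIcc (0 : ℝ) 1,
        HasDerivAt (fun s : ℝ => u (x + s • h)) (fderiv ℝ u (x + s • h) h) s := by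
      intro s _
      have h1 : HasDerivAt (fun s : ℝ => x + s • h) h s := by
        simpa using ((hasDerivAt_id s).smul_const h).const_add x
      exact ((hu.differentiable one_ne_zero) (x + s • h)).hasFDerivAt.comp_hasDerivAt s h1
    have := intervalIntegral.integral_eq_sub_of_hasDerivAt hd (hc.intervalIntegrable 0 1)
    simp only [one_smul, zero_smul, add_zero] at this
    rw [← this, intervalIntegral.integral_of_le zero_le_one]
    exact enorm_integral_le_lintegral_enorm _
  calc diffNorm u h ≤ ∫⁻ x, ∫⁻ s in Ioc (0 : ℝ) 1, ‖fderiv ℝ u (x + s • h) h‖ₑ :=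
        lintegral_mono hpt
    _ = ∫⁻ s in Ioc (0 : ℝ) 1, ∫⁻ x, ‖fderiv ℝ u (x + s • h) h‖ₑ := by
        apply lintegral_lintegral_swap
        exact hcont.measurable.enorm.aemeasurable
    _ = ∫⁻ s in Ioc (0 : ℝ) 1, ∫⁻ x, ‖fderiv ℝ u x h‖ₑ := by
        congr with s
        exact lintegral_add_right_eq_self (fun x => ‖fderiv ℝ u x h‖ₑ) (s • h)
    _ = _ := by simp

lemma diffNorm_le_liminf {u : ℕ → F → ℝ} {f : F → ℝ} (hu : ∀ j, Measurable (u j))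
    (hf : ∀ᵐ x, Tendsto (fun j => u j x) atTop (𝓝 (f x))) (h : F) :
    diffNorm f h ≤ liminf (fun j => diffNorm (u j) h) atTop := by
  refine le_trans (lintegral_mono_ae ?_)
    (lintegral_liminf_le (f := fun j x => ‖u j (x + h) - u j x‖ₑ)
      fun j => by have := hu j; fun_prop)
  have hf' : ∀ᵐ x, Tendsto (fun j => u j (x + h)) atTop (𝓝 (f (x + h))) :=
    (measurePreserving_add_right volume h).quasiMeasurePreserving.ae hf
  filter_upwards [hf, hf'] with x hx hx'
  exact ((hx'.sub hx).enorm).liminf_eq.ge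

lemma diffNorm_convolution_le {ρ f : F → ℝ} (hρ : Continuous ρ) (hρc : HasCompactSupport ρ)
    (hρ0 : ∀ x, 0 ≤ ρ x) (hρ1 : ∫ x, ρ x = 1) (hf : Measurable f) (hfl : LocallyIntegrable f)
    (h : F) :
    diffNorm (ρ ⋆[ContinuousLinearMap.lsmul ℝ ℝ] f) h ≤ diffNorm f h := by
  have hex : ConvolutionExists ρ f (ContinuousLinearMap.lsmul ℝ ℝ) volume :=
    hρc.convolutionExists_left _ hρ hfl
  have hpt : ∀ x, ‖(ρ ⋆[ContinuousLinearMap.lsmul ℝ ℝ] f) (x + h)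
      - (ρ ⋆[ContinuousLinearMap.lsmul ℝ ℝ] f) x‖ₑ
      ≤ ∫⁻ y, ‖ρ y‖ₑ * ‖f (x - y + h) - f (x - y)‖ₑ := by
    intro x
    rw [convolution_def, convolution_def, ← integral_sub (hex _) (hex _)]
    refine (enorm_integral_le_lintegral_enorm _).trans_eq ?_
    congr with y
    simp only [ContinuousLinearMap.lsmul_apply, smul_eq_mul]
    rw [← mul_sub, enorm_mul, sub_add_eq_add_sub]
  calc diffNorm (ρ ⋆[ContinuousLinearMap.lsmul ℝ ℝ] f) h
      ≤ ∫⁻ x, ∫⁻ y, ‖ρ y‖ₑ * ‖f (x - y + h) - f (x - y)‖ₑ := lintegral_mono hpt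
    _ = ∫⁻ y, ∫⁻ x, ‖ρ y‖ₑ * ‖f (x - y + h) - f (x - y)‖ₑ := by
        apply lintegral_lintegral_swap
        have := hρ.measurable
        fun_prop
    _ = ∫⁻ y, ‖ρ y‖ₑ * diffNorm f h := by
        congr with y
        rw [lintegral_const_mul _ (by fun_prop)]
        congr 1
        exact lintegral_sub_right_eq_self (fun x => ‖f (x + h) - f x‖ₑ) y
    _ = diffNorm f h := by
        rw [lintegral_mul_const _ (by have := hρ.measurable; fun_prop),
          ← ofReal_integral_norm_eq_lintegral_enorm (hρ.integrable_of_hasCompactSupport hρc)]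
        simp_rw [Real.norm_of_nonneg (hρ0 _), hρ1]
        simp

lemma lintegral_fderiv_le_liminf_diffNorm {u : F → ℝ} (hu : ContDiff ℝ 1 u) (h : F) :
    ∫⁻ x, ‖fderiv ℝ u x h‖ₑ
      ≤ liminf (fun s : ℝ => ‖s⁻¹‖ₑ * diffNorm u (s • h)) (𝓝[>] 0) := by
  have hm : Measurable u := hu.continuous.measurable
  have hscale : ∀ s : ℝ, ‖s⁻¹‖ₑ * diffNorm u (s • h)
      = ∫⁻ x, ‖s⁻¹ * (u (x + s • h) - u x)‖ₑ := by
    intro s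
    rw [diffNorm, ← lintegral_const_mul' _ _ enorm_ne_top]
    simp_rw [enorm_mul]
  simp_rw [hscale]
  refine le_trans (lintegral_mono fun x => ?_)
    (lintegral_liminf_le (f := fun (s : ℝ) x => ‖s⁻¹ * (u (x + s • h) - u x)‖ₑ)
      fun s => by fun_prop)
  have hd : HasDerivAt (fun s : ℝ => u (x + s • h)) (fderiv ℝ u x h) 0 := by
    have h1 : HasDerivAt (fun s : ℝ => x + s • h) h 0 := by
      simpa using ((hasDerivAt_id (0 : ℝ)).smul_const h).const_add x
    have h2 : HasFDerivAt u (fderiv ℝ u x) (x + (0 : ℝ) • h) := by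
      simpa using ((hu.differentiable one_ne_zero) x).hasFDerivAt
    exact h2.comp_hasDerivAt 0 h1
  have := hd.tendsto_slope_zero_right
  simp only [zero_add, zero_smul, add_zero, smul_eq_mul] at this
  exact this.enorm.liminf_eq.ge

/-- The Gaussian average of the directional derivatives of `u` is a multiple of the total variation
of `u`. -/
lemma lintegral_stdGaussian_fderiv {u : F → ℝ} (hu : ContDiff ℝ 1 u) :
    ∫⁻ k, (∫⁻ x, ‖fderiv ℝ u x k‖ₑ) ∂(ProbabilityTheory.stdGaussian F)
      = ENNReal.ofReal √(2 / π) * ∫⁻ x, ‖fderiv ℝ u x‖ₑ := by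
  have hc := hu.continuous_fderiv one_ne_zero
  rw [lintegral_lintegral_swap]
  · rw [lintegral_congr fun x => lintegral_enorm_dual_stdGaussian (fderiv ℝ u x),
      lintegral_const_mul _ hc.measurable.enorm]
  · exact ((hc.comp continuous_snd).clm_apply continuous_fst).measurable.enorm.aemeasurable

end DifferenceQuotients

section Divergence

open scoped Convolution

variable {n : ℕ}

/-- The trace of an endomorphism of `ℝⁿ`, as a continuous linear functional. -/
def traceCLM (n : ℕ) :
    (EuclideanSpace ℝ (Fin n) →L[ℝ] EuclideanSpace ℝ (Fin n)) →L[ℝ] ℝ :=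
  ∑ i : Fin n, (innerSL ℝ (EuclideanSpace.single i (1 : ℝ))).comp
    (ContinuousLinearMap.apply ℝ (EuclideanSpace ℝ (Fin n)) (EuclideanSpace.single i (1 : ℝ)))

lemma divergence_eq_traceCLM (X : EuclideanSpace ℝ (Fin n) → EuclideanSpace ℝ (Fin n))
    (x : EuclideanSpace ℝ (Fin n)) : divergence n X x = traceCLM n (fderiv ℝ X x) := by
  simp [divergence, traceCLM, real_inner_comm]

lemma divergence_neg (X : EuclideanSpace ℝ (Fin n) → EuclideanSpace ℝ (Fin n))
    (x : EuclideanSpace ℝ (Fin n)) : divergence n (-X) x = -divergence n X x := by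
  simp [divergence_eq_traceCLM, fderiv_neg]

lemma continuous_divergence {X : EuclideanSpace ℝ (Fin n) → EuclideanSpace ℝ (Fin n)}
    (hX : ContDiff ℝ 1 X) : Continuous (divergence n X) := by
  have : divergence n X = fun x => traceCLM n (fderiv ℝ X x) :=
    funext (divergence_eq_traceCLM X)
  rw [this]
  exact (traceCLM n).continuous.comp (hX.continuous_fderiv one_ne_zero)

lemma hasCompactSupport_divergence {X : EuclideanSpace ℝ (Fin n) → EuclideanSpace ℝ (Fin n)}
    (hXc : HasCompactSupport X) : HasCompactSupport (divergence n X) := by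
  have : divergence n X = (traceCLM n) ∘ (fderiv ℝ X) :=
    funext (divergence_eq_traceCLM X)
  rw [this]
  exact (hXc.fderiv ℝ).comp_left (map_zero _)

lemma integral_mul_divergence {u : EuclideanSpace ℝ (Fin n) → ℝ}
    {X : EuclideanSpace ℝ (Fin n) → EuclideanSpace ℝ (Fin n)} (hu : ContDiff ℝ 1 u)
    (hX : ContDiff ℝ 1 X) (hXc : HasCompactSupport X) :
    ∫ x, u x * divergence n X x = -∫ x, fderiv ℝ u x (X x) := by
  have hXi : ∀ i : Fin n, ContDiff ℝ 1 fun x => X x i := by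
    intro i; exact contDiff_euclidean.1 hX i
  have hXic : ∀ i : Fin n, HasCompactSupport fun x => X x i := fun i =>
    hXc.comp_left (g := fun v : EuclideanSpace ℝ (Fin n) => v i) rfl
  have hfd : ∀ (i : Fin n) x, ⟪fderiv ℝ X x (EuclideanSpace.single i 1),
      (EuclideanSpace.single i 1 : EuclideanSpace ℝ (Fin n))⟫
      = fderiv ℝ (fun y => X y i) x (EuclideanSpace.single i 1) := by
    intro i x
    have h := (EuclideanSpace.proj (𝕜 := ℝ) i).hasFDerivAt.comp x
      ((hX.differentiable one_ne_zero) x).hasFDerivAt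
    have h' : fderiv ℝ (fun y => X y i) x
        = (EuclideanSpace.proj (𝕜 := ℝ) i).comp (fderiv ℝ X x) := h.fderiv
    rw [h']
    simp [EuclideanSpace.inner_single_right]
  have hcu := hu.continuous
  have hcu' := hu.continuous_fderiv one_ne_zero
  have hi1 : ∀ i : Fin n, Integrable fun x =>
      u x * fderiv ℝ (fun y => X y i) x (EuclideanSpace.single i 1) := fun i =>
    (hcu.mul (((hXi i).continuous_fderiv one_ne_zero).clm_apply
      continuous_const)).integrable_of_hasCompactSupport
      (((hXic i).fderiv_apply ℝ _).mul_left)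
  have hi2 : ∀ i : Fin n, Integrable fun x =>
      fderiv ℝ u x (EuclideanSpace.single i 1) * X x i := fun i =>
    ((hcu'.clm_apply continuous_const).mul (hXi i).continuous).integrable_of_hasCompactSupport
      ((hXic i).mul_left)
  have hi3 : ∀ i : Fin n, Integrable fun x => u x * X x i := fun i =>
    (hcu.mul (hXi i).continuous).integrable_of_hasCompactSupport ((hXic i).mul_left)
  have hdec : ∀ x, fderiv ℝ u x (X x)
      = ∑ i : Fin n, fderiv ℝ u x (EuclideanSpace.single i 1) * X x i := by
    intro x
    conv_lhs => rw [← (EuclideanSpace.basisFun (Fin n) ℝ).sum_repr (X x)]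
    simp [mul_comm]
  simp_rw [divergence, hfd, Finset.mul_sum, hdec]
  rw [integral_finsetSum _ fun i _ => hi1 i, integral_finsetSum _ fun i _ => hi2 i,
    ← Finset.sum_neg_distrib]
  refine Finset.sum_congr rfl fun i _ => ?_
  exact integral_mul_fderiv_eq_neg_fderiv_mul_of_integrable (hi2 i) (hi1 i) (hi3 i)
    (fun x _ => (hu.differentiable one_ne_zero) x)
    (fun x _ => ((hXi i).differentiable one_ne_zero) x)

lemma divergence_convolution {ρ : EuclideanSpace ℝ (Fin n) → ℝ}
    {X : EuclideanSpace ℝ (Fin n) → EuclideanSpace ℝ (Fin n)} (hρ : Continuous ρ)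
    (hX : ContDiff ℝ 1 X) (hXc : HasCompactSupport X) (x : EuclideanSpace ℝ (Fin n)) :
    divergence n (ρ ⋆[ContinuousLinearMap.lsmul ℝ ℝ] X) x
      = (ρ ⋆[ContinuousLinearMap.lsmul ℝ ℝ] divergence n X) x := by
  have hd := hXc.hasFDerivAt_convolution_right (ContinuousLinearMap.lsmul ℝ ℝ)
    (hρ.locallyIntegrable (μ := volume)) hX x
  have hex := (hXc.fderiv ℝ).convolutionExists_right
    ((ContinuousLinearMap.lsmul ℝ ℝ : ℝ →L[ℝ] EuclideanSpace ℝ (Fin n) →L[ℝ]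
      EuclideanSpace ℝ (Fin n)).precompR (EuclideanSpace ℝ (Fin n)))
    (hρ.locallyIntegrable (μ := volume)) (hX.continuous_fderiv one_ne_zero) x
  rw [divergence_eq_traceCLM, hd.fderiv, convolution_def, convolution_def,
    ← ContinuousLinearMap.integral_comp_comm _ hex]
  congr with y
  rw [ContinuousLinearMap.lsmul_apply, divergence_eq_traceCLM, smul_eq_mul, ← smul_eq_mul,
    ← map_smul]
  congr 1

lemma integral_convolution_mul {ρ f g : EuclideanSpace ℝ (Fin n) → ℝ} (hρ : Continuous ρ)
    (hρc : HasCompactSupport ρ) (hρe : ∀ x, ρ (-x) = ρ x) (hf : Measurable f) {M : ℝ}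
    (hM : ∀ x, ‖f x‖ ≤ M) (hg : Integrable g) :
    ∫ x, (ρ ⋆[ContinuousLinearMap.lsmul ℝ ℝ] f) x * g x
      = ∫ x, f x * (ρ ⋆[ContinuousLinearMap.lsmul ℝ ℝ] g) x := by
  have hint : Integrable (fun p : EuclideanSpace ℝ (Fin n) × EuclideanSpace ℝ (Fin n) =>
      ρ (p.1 - p.2) * f p.2 * g p.1) (volume.prod volume) := by
    have h1 := (hg.convolution_integrand (ContinuousLinearMap.mul ℝ ℝ)
      (hρ.integrable_of_hasCompactSupport hρc (μ := volume))).swap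
    have h2 := h1.bdd_mul (f := fun p => f p.2) (c := M)
      (hf.comp measurable_snd).aestronglyMeasurable (ae_of_all _ fun p => hM p.2)
    refine h2.congr (ae_of_all _ fun p => ?_)
    simp only [Function.comp_apply, Prod.fst_swap, Prod.snd_swap, ContinuousLinearMap.mul_apply']
    rw [← neg_sub p.1 p.2, hρe]
    ring
  simp_rw [convolution_eq_swap, ContinuousLinearMap.lsmul_apply, smul_eq_mul,
    ← integral_mul_const, ← integral_const_mul]
  rw [integral_integral_swap hint]
  congr with y
  congr with x
  rw [← neg_sub y x, hρe]
  ring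

end Divergence

section TotalVariation

open scoped Convolution

variable {n : ℕ}

/-- Duality for the total variation of a `C²` function: it is bounded by any bound for the
pairings with admissible vector fields. -/
lemma lintegral_fderiv_le_of_forall_pairing_le {u : EuclideanSpace ℝ (Fin n) → ℝ}
    (hu : ContDiff ℝ 2 u) {P : ℝ}
    (hP : ∀ X : EuclideanSpace ℝ (Fin n) → EuclideanSpace ℝ (Fin n), ContDiff ℝ 1 X →
      HasCompactSupport X → (∀ x, ‖X x‖ ≤ 1) → ∫ x, fderiv ℝ u x (X x) ≤ P) :
    ∫⁻ x, ‖fderiv ℝ u x‖ₑ ≤ ENNReal.ofReal P := by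
  set g : EuclideanSpace ℝ (Fin n) → EuclideanSpace ℝ (Fin n) := fun x =>
    (InnerProductSpace.toDual ℝ (EuclideanSpace ℝ (Fin n))).symm (fderiv ℝ u x) with hg
  have hgC : ContDiff ℝ 1 g :=
    (InnerProductSpace.toDual ℝ (EuclideanSpace ℝ (Fin n))).symm.toContinuousLinearEquiv.contDiff.comp
      (hu.fderiv_right (by norm_num))
  have hginner : ∀ x v, fderiv ℝ u x v = ⟪g x, v⟫ := fun x v => by simp [hg]
  have hgnorm : ∀ x, ‖fderiv ℝ u x‖ = ‖g x‖ := fun x => by simp [hg]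
  let χ : ℕ → ContDiffBump (0 : EuclideanSpace ℝ (Fin n)) := fun j =>
    ⟨j + 1, j + 2, by positivity, by linarith⟩
  let δ : ℕ → ℝ := fun j => 1 / ((j : ℝ) + 1)
  have hδ : ∀ j, 0 < δ j := fun j => by positivity
  have hpos : ∀ j x, 0 < √(δ j + ‖g x‖ ^ 2) := fun j x =>
    Real.sqrt_pos.2 (add_pos_of_pos_of_nonneg (hδ j) (by positivity))
  let X : ℕ → EuclideanSpace ℝ (Fin n) → EuclideanSpace ℝ (Fin n) := fun j x =>
    (χ j x * (√(δ j + ‖g x‖ ^ 2))⁻¹) • g x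
  have hXC : ∀ j, ContDiff ℝ 1 (X j) := by
    intro j
    refine ContDiff.smul ((χ j).contDiff.mul (ContDiff.inv (ContDiff.sqrt
      (contDiff_const.add (hgC.norm_sq ℝ)) ?_) ?_)) hgC
    · intro x; exact (Real.sqrt_pos.1 (hpos j x)).ne'
    · intro x; exact (hpos j x).ne'
  have hXc : ∀ j, HasCompactSupport (X j) := fun j =>
    HasCompactSupport.smul_right (f := fun x => χ j x * (√(δ j + ‖g x‖ ^ 2))⁻¹)
      ((χ j).hasCompactSupport.mul_right)
  have hle : ∀ j x, ‖g x‖ ≤ √(δ j + ‖g x‖ ^ 2) := fun j x =>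
    Real.le_sqrt_of_sq_le (by linarith [hδ j])
  have hX1 : ∀ j x, ‖X j x‖ ≤ 1 := by
    intro j x
    rw [norm_smul, Real.norm_of_nonneg
      (mul_nonneg (χ j).nonneg (inv_nonneg.2 (hpos j x).le)), mul_assoc, ← div_eq_inv_mul]
    exact mul_le_one₀ (χ j).le_one (by positivity) ((div_le_one (hpos j x)).2 (hle j x))
  have hpair : ∀ j x, fderiv ℝ u x (X j x) = χ j x * (√(δ j + ‖g x‖ ^ 2))⁻¹ * ‖g x‖ ^ 2 := by
    intro j x
    rw [hginner, inner_smul_right, real_inner_self_eq_norm_sq]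
  have hpair0 : ∀ j x, 0 ≤ fderiv ℝ u x (X j x) := by
    intro j x
    rw [hpair]
    have := (χ j).nonneg (x := x)
    have := hpos j x
    positivity
  have hcont : ∀ j, Continuous fun x => fderiv ℝ u x (X j x) := fun j =>
    (hu.continuous_fderiv two_ne_zero).clm_apply (hXC j).continuous
  have hlim : ∀ x, Tendsto (fun j => fderiv ℝ u x (X j x)) atTop (𝓝 ‖g x‖) := by
    intro x
    have h1 : Tendsto δ atTop (𝓝 0) := tendsto_one_div_add_atTop_nhds_zero_nat
    have hχ : ∀ᶠ j : ℕ in atTop, χ j x = 1 := by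
      filter_upwards [eventually_ge_atTop ⌈‖x‖⌉₊] with j hj
      apply (χ j).one_of_mem_closedBall
      rw [mem_closedBall_zero_iff]
      exact (Nat.le_ceil _).trans ((Nat.cast_le.2 hj).trans (by simp [χ]))
    by_cases h0 : g x = 0
    · simp [hpair, h0]
    have h2 : Tendsto (fun j => (√(δ j + ‖g x‖ ^ 2))⁻¹ * ‖g x‖ ^ 2) atTop
        (𝓝 ((√(0 + ‖g x‖ ^ 2))⁻¹ * ‖g x‖ ^ 2)) := by
      refine Tendsto.mul_const _ (Tendsto.inv₀ ((h1.add_const _).sqrt) ?_)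
      simpa using h0
    have h3 : (√(0 + ‖g x‖ ^ 2))⁻¹ * ‖g x‖ ^ 2 = ‖g x‖ := by
      have := norm_ne_zero_iff.2 h0
      rw [zero_add, Real.sqrt_sq (norm_nonneg _)]
      field_simp
    rw [h3] at h2
    refine h2.congr' ?_
    filter_upwards [hχ] with j hj
    rw [hpair, hj, one_mul]
  calc ∫⁻ x, ‖fderiv ℝ u x‖ₑ
      = ∫⁻ x, liminf (fun j => ENNReal.ofReal (fderiv ℝ u x (X j x))) atTop := by
        congr with x
        rw [(ENNReal.tendsto_ofReal (hlim x)).liminf_eq, ← hgnorm, ofReal_norm]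
    _ ≤ liminf (fun j => ∫⁻ x, ENNReal.ofReal (fderiv ℝ u x (X j x))) atTop :=
        lintegral_liminf_le fun j => (hcont j).measurable.ennreal_ofReal
    _ ≤ liminf (fun _ : ℕ => ENNReal.ofReal P) atTop := by
        refine liminf_le_liminf (Eventually.of_forall fun j => ?_)
        have hint : Integrable fun x => fderiv ℝ u x (X j x) := by
          refine (hcont j).integrable_of_hasCompactSupport ((hXc j).mono ?_)
          intro x hx h0
          exact hx (by simp [h0])
        rw [← ofReal_integral_eq_lintegral_ofReal hint (ae_of_all _ (hpair0 j))]
        exact ENNReal.ofReal_le_ofReal (hP _ (hXC j) (hXc j) (hX1 j))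
    _ = _ := liminf_const _

variable {E : Set (EuclideanSpace ℝ (Fin n))}

lemma measurable_indicator_one (hE : MeasurableSet E) :
    Measurable (E.indicator fun _ => (1 : ℝ)) :=
  measurable_const.indicator hE

lemma norm_indicator_one_le (x : EuclideanSpace ℝ (Fin n)) :
    ‖E.indicator (fun _ => (1 : ℝ)) x‖ ≤ 1 := by
  by_cases h : x ∈ E <;> simp [h]

lemma locallyIntegrable_indicator_one (hE : MeasurableSet E) :
    LocallyIntegrable (E.indicator fun _ => (1 : ℝ)) :=
  (locallyIntegrable_const 1).indicator hE

lemma integral_indicator_one_mul (hE : MeasurableSet E) (g : EuclideanSpace ℝ (Fin n) → ℝ) :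
    ∫ x, E.indicator (fun _ => (1 : ℝ)) x * g x = ∫ x in E, g x := by
  rw [← integral_indicator hE]
  congr with x
  by_cases h : x ∈ E <;> simp [h]

/-- A mollification by an even probability density does not increase the perimeter. -/
lemma lintegral_fderiv_convolution_le (hE : MeasurableSet E) (hfin : HasFinitePerimeter n E)
    {ρ : EuclideanSpace ℝ (Fin n) → ℝ} (hρ : ContDiff ℝ 2 ρ) (hρc : HasCompactSupport ρ)
    (hρe : ∀ x, ρ (-x) = ρ x) (hρ0 : ∀ x, 0 ≤ ρ x) (hρ1 : ∫ x, ρ x = 1) :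
    ∫⁻ x, ‖fderiv ℝ (ρ ⋆[ContinuousLinearMap.lsmul ℝ ℝ] E.indicator fun _ => (1 : ℝ)) x‖ₑ
      ≤ ENNReal.ofReal (perim n E) := by
  have hu : ContDiff ℝ 2 (ρ ⋆[ContinuousLinearMap.lsmul ℝ ℝ] E.indicator fun _ => (1 : ℝ)) :=
    hρc.contDiff_convolution_left _ hρ (locallyIntegrable_indicator_one hE)
  refine lintegral_fderiv_le_of_forall_pairing_le hu fun X hX hXc hX1 => ?_
  have hY : ContDiff ℝ 1 (ρ ⋆[ContinuousLinearMap.lsmul ℝ ℝ] X) :=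
    hXc.contDiff_convolution_right _ (hρ.continuous.locallyIntegrable (μ := volume)) hX
  have hYc : HasCompactSupport (ρ ⋆[ContinuousLinearMap.lsmul ℝ ℝ] X) :=
    HasCompactSupport.convolution _ hρc hXc
  have hρi : Integrable ρ := hρ.continuous.integrable_of_hasCompactSupport hρc
  have hY1 : ∀ x, ‖(ρ ⋆[ContinuousLinearMap.lsmul ℝ ℝ] X) x‖ ≤ 1 := by
    intro x
    rw [convolution_def, ← hρ1]
    refine norm_integral_le_of_norm_le hρi (ae_of_all _ fun y => ?_)
    rw [ContinuousLinearMap.lsmul_apply, norm_smul, Real.norm_of_nonneg (hρ0 y)]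
    exact mul_le_of_le_one_right (hρ0 y) (hX1 _)
  have hdiv : Integrable (divergence n X) :=
    (continuous_divergence hX).integrable_of_hasCompactSupport (hasCompactSupport_divergence hXc)
  have hkey := integral_convolution_mul hρ.continuous hρc hρe (measurable_indicator_one hE)
    norm_indicator_one_le hdiv
  rw [integral_mul_divergence (hu.of_le (by norm_num)) hX hXc, integral_indicator_one_mul hE]
    at hkey
  rw [neg_eq_iff_eq_neg.1 hkey, ← integral_neg]
  refine le_csSup hfin ⟨-(ρ ⋆[ContinuousLinearMap.lsmul ℝ ℝ] X), hY.neg, hYc.neg, ?_, ?_⟩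
  · simpa using hY1
  · congr with x
    rw [divergence_neg, divergence_convolution hρ.continuous hX hXc]

/-- Lower semicontinuity of the perimeter, tested against a single vector field. -/
lemma tendsto_integral_mul_divergence (hE : MeasurableSet E)
    {u : ℕ → EuclideanSpace ℝ (Fin n) → ℝ} (hu : ∀ j, Continuous (u j)) (hu1 : ∀ j x, ‖u j x‖ ≤ 1)
    (hlim : ∀ᵐ x, Tendsto (fun j => u j x) atTop (𝓝 (E.indicator (fun _ => (1 : ℝ)) x)))
    {X : EuclideanSpace ℝ (Fin n) → EuclideanSpace ℝ (Fin n)} (hX : ContDiff ℝ 1 X)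
    (hXc : HasCompactSupport X) :
    Tendsto (fun j => ∫ x, u j x * divergence n X x) atTop
      (𝓝 (∫ x in E, divergence n X x)) := by
  rw [← integral_indicator_one_mul hE]
  have hdiv : Integrable (divergence n X) :=
    (continuous_divergence hX).integrable_of_hasCompactSupport (hasCompactSupport_divergence hXc)
  refine tendsto_integral_of_dominated_convergence (fun x => ‖divergence n X x‖)
    (fun j => ((hu j).mul (continuous_divergence hX)).aestronglyMeasurable) hdiv.norm
    (fun j => ae_of_all _ fun x => ?_) ?_
  · rw [norm_mul]
    exact mul_le_of_le_one_left (norm_nonneg _) (hu1 j x)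
  · filter_upwards [hlim] with x hx using hx.mul_const _

lemma ofReal_integral_mul_divergence_le {u : EuclideanSpace ℝ (Fin n) → ℝ} (hu : ContDiff ℝ 1 u)
    {X : EuclideanSpace ℝ (Fin n) → EuclideanSpace ℝ (Fin n)} (hX : ContDiff ℝ 1 X)
    (hXc : HasCompactSupport X) (hX1 : ∀ x, ‖X x‖ ≤ 1) :
    ENNReal.ofReal (∫ x, u x * divergence n X x) ≤ ∫⁻ x, ‖fderiv ℝ u x‖ₑ := by
  rw [integral_mul_divergence hu hX hXc, ← integral_neg]
  refine (Real.ofReal_le_enorm _).trans ((enorm_integral_le_lintegral_enorm _).trans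
    (lintegral_mono fun x => ?_))
  rw [enorm_neg, ← ofReal_norm, ← ofReal_norm]
  refine ENNReal.ofReal_le_ofReal (((fderiv ℝ u x).le_opNorm _).trans ?_)
  exact mul_le_of_le_one_right (norm_nonneg _) (hX1 x)

/-- An indicator function of finite perimeter is an almost everywhere limit of smooth functions
with values in `[-1, 1]`, with total variation at most the perimeter, and with `L¹` increments
bounded by those of the indicator. -/
lemma exists_smooth_approximation (hE : MeasurableSet E) (hfin : HasFinitePerimeter n E) :
    ∃ u : ℕ → EuclideanSpace ℝ (Fin n) → ℝ, (∀ j, ContDiff ℝ 1 (u j)) ∧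
      (∀ j x, ‖u j x‖ ≤ 1) ∧
      (∀ᵐ x, Tendsto (fun j => u j x) atTop (𝓝 (E.indicator (fun _ => (1 : ℝ)) x))) ∧
      (∀ j, ∫⁻ x, ‖fderiv ℝ (u j) x‖ₑ ≤ ENNReal.ofReal (perim n E)) ∧
      (∀ j h, diffNorm (u j) h ≤ diffNorm (E.indicator fun _ => (1 : ℝ)) h) := by
  let φ : ℕ → ContDiffBump (0 : EuclideanSpace ℝ (Fin n)) := fun j =>
    ⟨1 / ((j : ℝ) + 1), 2 * (1 / ((j : ℝ) + 1)), by positivity,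
      lt_mul_of_one_lt_left (by positivity) one_lt_two⟩
  have hli := locallyIntegrable_indicator_one hE
  refine ⟨fun j => (φ j).normed volume ⋆[ContinuousLinearMap.lsmul ℝ ℝ]
    E.indicator fun _ => (1 : ℝ), fun j => ?_, fun j x => ?_, ?_, fun j => ?_, fun j h => ?_⟩
  · exact (φ j).hasCompactSupport_normed.contDiff_convolution_left _ (φ j).contDiff_normed hli
  · have hi : Integrable ((φ j).normed volume) := (φ j).integrable_normed
    refine (norm_integral_le_of_norm_le hi (ae_of_all _ fun y => ?_)).trans_eq
      (φ j).integral_normed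
    rw [ContinuousLinearMap.lsmul_apply, norm_smul, Real.norm_of_nonneg ((φ j).nonneg_normed y)]
    exact mul_le_of_le_one_right ((φ j).nonneg_normed y) (norm_indicator_one_le _)
  · refine ContDiffBump.ae_convolution_tendsto_right_of_locallyIntegrable (K := 2) ?_
      (Eventually.of_forall fun j => le_rfl) hli
    simpa [φ] using (tendsto_one_div_add_atTop_nhds_zero_nat (𝕜 := ℝ)).const_mul 2
  · exact lintegral_fderiv_convolution_le hE hfin (φ j).contDiff_normed
      (φ j).hasCompactSupport_normed (φ j).normed_neg (φ j).nonneg_normed (φ j).integral_normed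
  · exact diffNorm_convolution_le (φ j).continuous_normed (φ j).hasCompactSupport_normed
      (φ j).nonneg_normed (φ j).integral_normed (measurable_indicator_one hE) hli h

end TotalVariation

section HeatContent

variable {n : ℕ} {E : Set (EuclideanSpace ℝ (Fin n))}

lemma zero_mem_perimSet : (0 : ℝ) ∈ perimSet n E :=
  ⟨0, contDiff_const, HasCompactSupport.zero, by simp, by simp [divergence_eq_traceCLM]⟩

lemma perim_nonneg (hfin : HasFinitePerimeter n E) : 0 ≤ perim n E :=
  le_csSup hfin zero_mem_perimSet

lemma enorm_integral_eq_lintegral_of_sign {α : Type*} [MeasurableSpace α] {μ : Measure α}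
    {w : α → ℝ} (hw : Integrable w μ) (hs : (∀ x, 0 ≤ w x) ∨ ∀ x, w x ≤ 0) :
    ‖∫ x, w x ∂μ‖ₑ = ∫⁻ x, ‖w x‖ₑ ∂μ := by
  rw [← ofReal_integral_norm_eq_lintegral_enorm hw, ← ofReal_norm]
  congr 1
  rcases hs with hs | hs
  · rw [Real.norm_of_nonneg (integral_nonneg hs)]
    simp_rw [fun x => Real.norm_of_nonneg (hs x)]
  · rw [Real.norm_of_nonpos (integral_nonpos hs), ← integral_neg]
    simp_rw [fun x => Real.norm_of_nonpos (hs x)]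

/-- The `L¹` distance between `E` and its heat evolution is a Gaussian average of the `L¹`
increments of the indicator of `E`. -/
lemma integral_abs_heat_sub_indicator (hE : MeasurableSet E) {t : ℝ} (ht : 0 < t) :
    ∫ x, |(∫ y, E.indicator (fun _ => (1 : ℝ)) y * heatKer n t (x - y))
        - E.indicator (fun _ => (1 : ℝ)) x|
      = (∫⁻ k, diffNorm (E.indicator fun _ => (1 : ℝ)) (√(2 * t) • k)
          ∂(ProbabilityTheory.stdGaussian (EuclideanSpace ℝ (Fin n)))).toReal := by
  set f : EuclideanSpace ℝ (Fin n) → ℝ := E.indicator fun _ => (1 : ℝ) with hf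
  have hfm : Measurable f := measurable_indicator_one hE
  have hGm : Measurable (heatKer n t) := continuous_heatKer.measurable
  have hGi : Integrable (heatKer n t) := integrable_heatKer ht
  have hint : ∀ x, Integrable fun h => f (x + h) * heatKer n t h := fun x =>
    hGi.bdd_mul (c := 1) (hfm.comp (measurable_const_add x)).aestronglyMeasurable
      (ae_of_all _ fun h => norm_indicator_one_le _)
  have hp : ∀ x, (∫ y, f y * heatKer n t (x - y)) - f x
      = ∫ h, (f (x + h) - f x) * heatKer n t h := by
    intro x
    rw [← integral_add_left_eq_self (fun y => f y * heatKer n t (x - y)) x]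
    simp_rw [sub_add_cancel_left, heatKer_neg, sub_mul]
    rw [integral_sub (hint x) (hGi.const_mul _), integral_const_mul, integral_heatKer ht, mul_one]
  have hsign : ∀ x, (∀ h, 0 ≤ (f (x + h) - f x) * heatKer n t h) ∨
      ∀ h, (f (x + h) - f x) * heatKer n t h ≤ 0 := by
    intro x
    by_cases hx : x ∈ E
    · refine Or.inr fun h => mul_nonpos_of_nonpos_of_nonneg ?_ (heatKer_nonneg ht h)
      by_cases hh : x + h ∈ E <;> simp [hf, hx, hh]
    · refine Or.inl fun h => mul_nonneg ?_ (heatKer_nonneg ht h)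
      by_cases hh : x + h ∈ E <;> simp [hf, hx, hh]
  have hint' : ∀ x, Integrable fun h => (f (x + h) - f x) * heatKer n t h := by
    intro x
    simp_rw [sub_mul]
    exact (hint x).sub (hGi.const_mul _)
  have hmeas : StronglyMeasurable fun x => ∫ h, (f (x + h) - f x) * heatKer n t h := by
    apply StronglyMeasurable.integral_prod_right
      (f := fun x h => (f (x + h) - f x) * heatKer n t h)
    apply Measurable.stronglyMeasurable
    simp only [Function.uncurry_def]
    fun_prop
  simp_rw [hp, ← Real.norm_eq_abs]
  rw [integral_norm_eq_lintegral_enorm hmeas.aestronglyMeasurable,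
    ← lintegral_heatKer_mul ht (measurable_diffNorm hfm)]
  congr 1
  simp_rw [fun x => enorm_integral_eq_lintegral_of_sign (hint' x) (hsign x)]
  rw [lintegral_lintegral_swap (by fun_prop)]
  congr with h
  simp_rw [enorm_mul, mul_comm _ ‖heatKer n t h‖ₑ]
  rw [lintegral_const_mul _ (by fun_prop), Real.enorm_of_nonneg (heatKer_nonneg ht h)]
  rfl

lemma lintegral_diffNorm_indicator_le (hE : MeasurableSet E) (hfin : HasFinitePerimeter n E)
    {s : ℝ} (hs : 0 < s) :
    ‖s⁻¹‖ₑ * ∫⁻ k, diffNorm (E.indicator fun _ => (1 : ℝ)) (s • k)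
        ∂(ProbabilityTheory.stdGaussian (EuclideanSpace ℝ (Fin n)))
      ≤ ENNReal.ofReal √(2 / π) * ENNReal.ofReal (perim n E) := by
  obtain ⟨u, hu, -, hlim, hper, -⟩ := exists_smooth_approximation hE hfin
  have hstep : ∀ j (k : EuclideanSpace ℝ (Fin n)),
      diffNorm (u j) (s • k) ≤ ‖s‖ₑ * ∫⁻ x, ‖fderiv ℝ (u j) x k‖ₑ := by
    intro j k
    refine (diffNorm_le_lintegral_fderiv (hu j) _).trans_eq ?_
    simp_rw [map_smul, enorm_smul]
    exact lintegral_const_mul' _ _ enorm_ne_top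
  have hmj : ∀ j, Measurable (u j) := fun j => (hu j).continuous.measurable
  have hbound : ∫⁻ k, diffNorm (E.indicator fun _ => (1 : ℝ)) (s • k)
        ∂(ProbabilityTheory.stdGaussian (EuclideanSpace ℝ (Fin n)))
      ≤ ‖s‖ₑ * (ENNReal.ofReal √(2 / π) * ENNReal.ofReal (perim n E)) :=
    calc _ ≤ ∫⁻ k, liminf (fun j => diffNorm (u j) (s • k)) atTop
          ∂(ProbabilityTheory.stdGaussian (EuclideanSpace ℝ (Fin n))) :=
        lintegral_mono fun k => diffNorm_le_liminf hmj hlim _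
      _ ≤ liminf (fun j => ∫⁻ k, diffNorm (u j) (s • k)
          ∂(ProbabilityTheory.stdGaussian (EuclideanSpace ℝ (Fin n)))) atTop :=
        lintegral_liminf_le fun j => (measurable_diffNorm (hmj j)).comp (measurable_const_smul s)
      _ ≤ liminf (fun _ : ℕ => ‖s‖ₑ *
          (ENNReal.ofReal √(2 / π) * ENNReal.ofReal (perim n E))) atTop := by
        refine liminf_le_liminf (Eventually.of_forall fun j => ?_)
        refine (lintegral_mono (hstep j)).trans ?_
        rw [lintegral_const_mul' _ _ enorm_ne_top, lintegral_stdGaussian_fderiv (hu j)]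
        gcongr
        exact hper j
      _ = _ := liminf_const _
  calc _ ≤ ‖s⁻¹‖ₑ * (‖s‖ₑ * (ENNReal.ofReal √(2 / π) * ENNReal.ofReal (perim n E))) := by
        gcongr
    _ = _ := by rw [← mul_assoc, ← enorm_mul, inv_mul_cancel₀ hs.ne', enorm_one, one_mul]

lemma le_liminf_lintegral_diffNorm_indicator (hE : MeasurableSet E)
    (hfin : HasFinitePerimeter n E) :
    ENNReal.ofReal √(2 / π) * ENNReal.ofReal (perim n E)
      ≤ liminf (fun s : ℝ => ‖s⁻¹‖ₑ * ∫⁻ k, diffNorm (E.indicator fun _ => (1 : ℝ)) (s • k)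
        ∂(ProbabilityTheory.stdGaussian (EuclideanSpace ℝ (Fin n)))) (𝓝[>] 0) := by
  obtain ⟨u, hu, hu1, hlim, -, hdiff⟩ := exists_smooth_approximation hE hfin
  set Λ := liminf (fun s : ℝ => ‖s⁻¹‖ₑ * ∫⁻ k, diffNorm (E.indicator fun _ => (1 : ℝ)) (s • k)
        ∂(ProbabilityTheory.stdGaussian (EuclideanSpace ℝ (Fin n)))) (𝓝[>] 0)
  have hvar : ∀ j, ENNReal.ofReal √(2 / π) * ∫⁻ x, ‖fderiv ℝ (u j) x‖ₑ ≤ Λ := by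
    intro j
    have hmj : Measurable (u j) := (hu j).continuous.measurable
    rw [← lintegral_stdGaussian_fderiv (hu j)]
    calc _ ≤ ∫⁻ k, liminf (fun s : ℝ => ‖s⁻¹‖ₑ * diffNorm (u j) (s • k)) (𝓝[>] 0)
          ∂(ProbabilityTheory.stdGaussian (EuclideanSpace ℝ (Fin n))) :=
        lintegral_mono fun k => lintegral_fderiv_le_liminf_diffNorm (hu j) k
      _ ≤ liminf (fun s : ℝ => ∫⁻ k, ‖s⁻¹‖ₑ * diffNorm (u j) (s • k)
          ∂(ProbabilityTheory.stdGaussian (EuclideanSpace ℝ (Fin n)))) (𝓝[>] 0) :=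
        lintegral_liminf_le fun s =>
          ((measurable_diffNorm hmj).comp (measurable_const_smul s)).const_mul _
      _ ≤ Λ := by
        refine liminf_le_liminf (Eventually.of_forall fun s => ?_)
        rw [lintegral_const_mul' _ _ enorm_ne_top]
        gcongr
        exact hdiff j _
  have hmem : ∀ r ∈ perimSet n E, ENNReal.ofReal √(2 / π) * ENNReal.ofReal r ≤ Λ := by
    rintro r ⟨X, hX, hXc, hX1, rfl⟩
    have h := ENNReal.Tendsto.const_mul (a := ENNReal.ofReal √(2 / π))
      (ENNReal.tendsto_ofReal (tendsto_integral_mul_divergence hE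
        (fun j => (hu j).continuous) hu1 hlim hX hXc)) (Or.inr ENNReal.ofReal_ne_top)
    refine le_of_tendsto' h fun j => le_trans ?_ (hvar j)
    gcongr
    exact ofReal_integral_mul_divergence_le (hu j) hX hXc hX1
  obtain ⟨r, -, hr, hrm⟩ := exists_seq_tendsto_sSup ⟨0, zero_mem_perimSet⟩ hfin
  have h := ENNReal.Tendsto.const_mul (a := ENNReal.ofReal √(2 / π))
    (ENNReal.tendsto_ofReal hr) (Or.inr ENNReal.ofReal_ne_top)
  exact le_of_tendsto' h fun m => hmem _ (hrm m)

lemma tendsto_lintegral_diffNorm_indicator (hE : MeasurableSet E)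
    (hfin : HasFinitePerimeter n E) :
    Tendsto (fun s : ℝ => s⁻¹ * (∫⁻ k, diffNorm (E.indicator fun _ => (1 : ℝ)) (s • k)
        ∂(ProbabilityTheory.stdGaussian (EuclideanSpace ℝ (Fin n)))).toReal) (𝓝[>] 0)
      (𝓝 (√(2 / π) * perim n E)) := by
  have h : Tendsto (fun s : ℝ => ‖s⁻¹‖ₑ * ∫⁻ k, diffNorm (E.indicator fun _ => (1 : ℝ)) (s • k)
        ∂(ProbabilityTheory.stdGaussian (EuclideanSpace ℝ (Fin n)))) (𝓝[>] 0)
      (𝓝 (ENNReal.ofReal √(2 / π) * ENNReal.ofReal (perim n E))) := by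
    refine tendsto_of_le_liminf_of_limsup_le (le_liminf_lintegral_diffNorm_indicator hE hfin)
      (limsup_le_of_le (by isBoundedDefault) ?_)
    filter_upwards [self_mem_nhdsWithin] with s hs
    exact lintegral_diffNorm_indicator_le hE hfin hs
  have h' := (ENNReal.tendsto_toReal
    (ENNReal.mul_ne_top ENNReal.ofReal_ne_top ENNReal.ofReal_ne_top)).comp h
  rw [ENNReal.toReal_mul, ENNReal.toReal_ofReal (by positivity),
    ENNReal.toReal_ofReal (perim_nonneg hfin)] at h'
  refine h'.congr' ?_
  filter_upwards [self_mem_nhdsWithin] with s hs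
  have hs' : (0 : ℝ) ≤ s⁻¹ := (inv_pos.2 hs).le
  simp only [Function.comp_apply, ENNReal.toReal_mul, toReal_enorm, Real.norm_of_nonneg hs']

end HeatContent

/-- **Euclidean `L¹` heat-content law for finite-perimeter sets.**
Let `E ⊆ ℝⁿ` be a set of finite perimeter and `p_t = 1_E * G_t` its Gaussian
smoothing.  Then, as `t ↓ 0`,
`‖p_t − 1_E‖_{L¹(ℝⁿ)} = (2/√π) √t · Per(E) + o(√t)`. -/
theorem euclidean_heat_content_finite_perimeter
    (n : ℕ) (E : Set (EuclideanSpace ℝ (Fin n))) (hE : MeasurableSet E)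
    (hfin : HasFinitePerimeter n E) :
    (fun t : ℝ =>
        (∫ x, |(∫ y, E.indicator (fun _ => (1:ℝ)) y * heatKer n t (x - y))
            - E.indicator (fun _ => (1:ℝ)) x|)
          - 2 / Real.sqrt Real.pi * Real.sqrt t * perim n E)
      =o[𝓝[>] (0 : ℝ)] fun t => Real.sqrt t := by
  have hs : Tendsto (fun t : ℝ => √(2 * t)) (𝓝[>] 0) (𝓝[>] 0) := by
    refine tendsto_nhdsWithin_iff.2 ⟨?_, ?_⟩
    · have : Continuous fun t : ℝ => √(2 * t) := by fun_prop
      simpa using (this.tendsto 0).mono_left nhdsWithin_le_nhds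
    · filter_upwards [self_mem_nhdsWithin] with t ht
      exact Real.sqrt_pos.2 (mul_pos two_pos ht)
  have hlim := (((tendsto_lintegral_diffNorm_indicator hE hfin).comp hs).const_mul √2).sub_const
    (2 / √π * perim n E)
  have hconst : √2 * (√(2 / π) * perim n E) - 2 / √π * perim n E = 0 := by
    rw [Real.sqrt_div two_pos.le, ← mul_assoc, mul_div_assoc', Real.mul_self_sqrt two_pos.le,
      sub_self]
  rw [hconst] at hlim
  refine (Asymptotics.isLittleO_iff_tendsto' ?_).2 (hlim.congr' ?_)
  · filter_upwards [self_mem_nhdsWithin] with t ht h0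
    exact absurd h0 (Real.sqrt_pos.2 ht).ne'
  · filter_upwards [self_mem_nhdsWithin] with t ht
    have ht' : √t ≠ 0 := (Real.sqrt_pos.2 ht).ne'
    have h2 : √2 ≠ 0 := (Real.sqrt_pos.2 two_pos).ne'
    have hm : √(2 * t) = √2 * √t := Real.sqrt_mul two_pos.le t
    rw [integral_abs_heat_sub_indicator hE ht]
    simp only [Function.comp_apply]
    generalize (∫⁻ k, diffNorm (E.indicator fun _ => (1 : ℝ)) (√(2 * t) • k)
      ∂(ProbabilityTheory.stdGaussian (EuclideanSpace ℝ (Fin n)))).toReal = A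
    rw [hm]
    field_simp

end
end
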